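/- Let n ≥ 1 and h ∈ L²(ℝⁿ × ℝⁿ; ℂ). Define K_h ∈ L²(ℝⁿ × ℝⁿ; ℂ) as the composition of the (L²-extended) Fourier transform of h in its second variable with the measure-preserving linear change of variables (x,y) ↦ ((x+y)/2, x−y); formally K_h(x,y) = (2π)^{−n} ∫_{ℝⁿ} h((x+y)/2, p) e^{i⟨p, x−y⟩} dp. Then h ↦ K_h is a linear bijection of L²(ℝⁿ × ℝⁿ; ℂ) onto itself which is a constant multiple of an isometry: ‖K_h‖_{L²} = (2π)^{−n/2} ‖h‖_{L²}. Consequently, for every h ∈ L²(ℝⁿ × ℝⁿ) the Weyl operator Op(h), i.e. the integral operator on L²(ℝⁿ) with kernel K_h, is Hilbert–Schmidt with Hilbert–Schmidt norm (2π)^{−n/2}‖h‖_{L²}; in this sense Weyl quantization works for all L² classical Hamilton functions. -/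

import Mathlib

open MeasureTheory Complex

open scoped FourierTransform ENNReal SchwartzMap

/-- The `L²` Fourier transform of an integrable function is given by the Fourier integral. -/
theorem fourier_toLp_ae_eq {V : Type*} [NormedAddCommGroup V] [InnerProductSpace ℝ V]
    [FiniteDimensional ℝ V] [MeasurableSpace V] [BorelSpace V] {f : V → ℂ}
    (hf : Integrable f) (hf2 : MemLp f 2) :
    (𝓕 (hf2.toLp f) : Lp ℂ 2 (volume : Measure V)) =ᵐ[volume] 𝓕 f := by
  have hcont : Continuous (𝓕 f) :=
    VectorFourier.fourierIntegral_continuous Real.continuous_fourierChar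
      continuous_inner hf
  refine ae_eq_of_integral_contDiff_smul_eq
    ((Lp.memLp _).locallyIntegrable (by norm_num)) hcont.locallyIntegrable ?_
  intro g hg hgs
  have hs : HasCompactSupport (fun x => (g x : ℂ)) :=
    hgs.comp_left (g := fun r : ℝ => (r : ℂ)) (by simp)
  have hd : ContDiff ℝ ((⊤ : ℕ∞) : WithTop ℕ∞) (fun x => (g x : ℂ)) :=
    Complex.ofRealCLM.contDiff.comp hg
  let φ : 𝓢(V, ℂ) := hs.toSchwartzMap hd
  have hφ : ∀ x, φ x = (g x : ℂ) := fun x => rfl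
  have h1 : ∫ x, (𝓕 φ) x • (hf2.toLp f) x =
      ∫ x, φ x • (𝓕 (hf2.toLp f) : Lp ℂ 2 (volume : Measure V)) x := by
    rw [← Lp.toTemperedDistribution_apply, ← Lp.toTemperedDistribution_apply,
      ← Lp.fourier_toTemperedDistribution_eq, TemperedDistribution.fourier_apply]
  have h2 : ∫ x, (𝓕 (φ : V → ℂ)) x • f x = ∫ x, φ x • 𝓕 f x :=
    by simpa using! (VectorFourier.integral_fourierIntegral_smul_eq_flip (L := innerₗ V)
      Real.continuous_fourierChar continuous_inner (φ.integrable (μ := volume)) hf)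
  calc ∫ x, g x • (𝓕 (hf2.toLp f) : Lp ℂ 2 (volume : Measure V)) x
      = ∫ x, φ x • (𝓕 (hf2.toLp f) : Lp ℂ 2 (volume : Measure V)) x := by simp [hφ]
    _ = ∫ x, (𝓕 φ) x • (hf2.toLp f) x := h1.symm
    _ = ∫ x, (𝓕 (φ : V → ℂ)) x • f x := by
      refine integral_congr_ae ?_
      filter_upwards [hf2.coeFn_toLp] with x hx
      rw [hx, SchwartzMap.fourier_coe]
    _ = ∫ x, φ x • 𝓕 f x := h2
    _ = ∫ x, g x • 𝓕 f x := by simp [hφ]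

/-- Plancherel's theorem for functions in `L¹ ∩ L²`. -/
theorem lintegral_enorm_sq_fourier_eq {V : Type*} [NormedAddCommGroup V] [InnerProductSpace ℝ V]
    [FiniteDimensional ℝ V] [MeasurableSpace V] [BorelSpace V] {f : V → ℂ}
    (hf : Integrable f) (hf2 : MemLp f 2) :
    ∫⁻ ξ, ‖𝓕 f ξ‖ₑ ^ 2 = ∫⁻ x, ‖f x‖ₑ ^ 2 := by
  have h : ‖(𝓕 (hf2.toLp f) : Lp ℂ 2 (volume : Measure V))‖ₑ = ‖hf2.toLp f‖ₑ := by
    rw [← ofReal_norm, ← ofReal_norm, Lp.norm_fourier_eq]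
  rw [Lp.enorm_def, Lp.enorm_def, eLpNorm_congr_ae (fourier_toLp_ae_eq hf hf2),
    eLpNorm_congr_ae hf2.coeFn_toLp] at h
  have := congrArg (· ^ (2 : ℝ)) h
  rw [eLpNorm_eq_lintegral_rpow_enorm_toReal (by norm_num) (by norm_num),
    eLpNorm_eq_lintegral_rpow_enorm_toReal (by norm_num) (by norm_num)] at this
  simp only [ENNReal.toReal_ofNat, ← ENNReal.rpow_mul] at this
  norm_num at this
  exact this

/-- The unitarily normalized Fourier integral `(2π)^{-n/2} ∫ f(p) e^{i s ⟨p, v⟩} dp`. -/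
noncomputable def planeWaveTransform {n : ℕ} (s : ℝ) (f : (Fin n → ℝ) → ℂ) (v : Fin n → ℝ) : ℂ :=
  ((Real.sqrt ((2 * Real.pi) ^ n))⁻¹ : ℝ) •
    ∫ p : Fin n → ℝ, f p * exp (I * ((s * ∑ i, p i * v i : ℝ) : ℂ))

theorem planeWaveTransform_eq_fourier {n : ℕ} (s : ℝ) (f : (Fin n → ℝ) → ℂ) (v : Fin n → ℝ) :
    planeWaveTransform s f v = ((Real.sqrt ((2 * Real.pi) ^ n))⁻¹ : ℝ) •
      𝓕 (fun x : EuclideanSpace ℝ (Fin n) => f x.ofLp)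
        (WithLp.toLp 2 ((-s / (2 * Real.pi)) • v)) := by
  rw [planeWaveTransform, Real.fourier_eq]
  congr 1
  rw [← (PiLp.volume_preserving_toLp (Fin n)).integral_comp
    (MeasurableEquiv.toLp 2 (Fin n → ℝ)).measurableEmbedding]
  congr 1 with p
  rw [Circle.smul_def, smul_eq_mul, mul_comm, Real.fourierChar_apply]
  have h : s * ∑ i, p i * v i = 2 * Real.pi *
      -inner ℝ (WithLp.toLp 2 p) (WithLp.toLp 2 ((-s / (2 * Real.pi)) • v)) := by
    simp only [PiLp.inner_apply, RCLike.inner_apply, Finset.mul_sum, Pi.smul_apply, smul_eq_mul,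
      ← Finset.sum_neg_distrib, conj_trivial]
    refine Finset.sum_congr rfl fun i _ => ?_
    field_simp
  rw [h, mul_comm I]

theorem lintegral_enorm_sq_planeWaveTransform {n : ℕ} {s : ℝ} (hs : |s| = 1)
    {f : (Fin n → ℝ) → ℂ} (hf : Integrable f) (hf2 : MemLp f 2) :
    ∫⁻ v, ‖planeWaveTransform s f v‖ₑ ^ 2 = ∫⁻ p, ‖f p‖ₑ ^ 2 := by
  have hmp := PiLp.volume_preserving_ofLp (Fin n)
  have hme := (MeasurableEquiv.toLp 2 (Fin n → ℝ)).symm.measurableEmbedding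
  have hF := lintegral_enorm_sq_fourier_eq (f := fun x : EuclideanSpace ℝ (Fin n) => f x.ofLp)
    (hmp.integrable_comp_of_integrable hf) (hf2.comp_measurePreserving hmp)
  rw [hmp.lintegral_comp_emb hme (fun p => ‖f p‖ₑ ^ 2),
    ← (PiLp.volume_preserving_toLp (Fin n)).lintegral_comp_emb
    (MeasurableEquiv.toLp 2 (Fin n → ℝ)).measurableEmbedding] at hF
  rw [← hF]
  have hr : -s / (2 * Real.pi) ≠ 0 := by
    have := Real.pi_pos
    have : s ≠ 0 := by rintro rfl; simp at hs
    exact div_ne_zero (neg_ne_zero.mpr this) (by positivity)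
  have hsc := Measure.map_addHaar_smul (volume : Measure (Fin n → ℝ)) hr
  have : ∀ G : (Fin n → ℝ) → ℝ≥0∞, ∫⁻ v, G ((-s / (2 * Real.pi)) • v) =
      ENNReal.ofReal ((2 * Real.pi) ^ n) * ∫⁻ v, G v := by
    intro G
    rw [← (measurableEmbedding_const_smul₀ hr).lintegral_map, hsc, lintegral_smul_measure]
    rw [Module.finrank_fin_fun, abs_inv, abs_pow, abs_div, abs_neg, hs, abs_of_pos Real.two_pi_pos,
      one_div, inv_pow, inv_inv, smul_eq_mul]
  simp_rw [planeWaveTransform_eq_fourier, enorm_smul, mul_pow (M := ℝ≥0∞)]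
  rw [lintegral_const_mul' _ _ (ENNReal.pow_ne_top enorm_ne_top), this (fun v =>
      ‖𝓕 (fun x : EuclideanSpace ℝ (Fin n) => f x.ofLp) (WithLp.toLp 2 v)‖ₑ ^ 2), ← mul_assoc]
  have hpos : 0 < (2 * Real.pi) ^ n := by positivity
  rw [Real.enorm_of_nonneg (by positivity), ← ENNReal.ofReal_pow (by positivity),
    ← ENNReal.ofReal_mul (by positivity), inv_pow, Real.sq_sqrt hpos.le,
    inv_mul_cancel₀ hpos.ne', ENNReal.ofReal_one, one_mul]

/-- The transforms with opposite signs in the phase are formally adjoint. -/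
theorem integral_conj_planeWaveTransform_mul {n : ℕ} (s : ℝ) {f g : (Fin n → ℝ) → ℂ}
    (hf : Integrable f) (hg : Integrable g) :
    ∫ v, (starRingEnd ℂ) (planeWaveTransform s f v) * g v =
      ∫ p, (starRingEnd ℂ) (f p) * planeWaveTransform (-s) g p := by
  let L : (Fin n → ℝ) →ₗ[ℝ] (Fin n → ℝ) →ₗ[ℝ] ℝ := (-s) • dotProductBilin ℝ ℝ
  have hL : Continuous fun p : (Fin n → ℝ) × (Fin n → ℝ) => L p.1 p.2 := by
    simp only [L, LinearMap.smul_apply, dotProductBilin_apply_apply, dotProduct]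
    fun_prop
  have h := VectorFourier.integral_sesq_fourierIntegral_eq_neg_flip (μ := volume) (ν := volume)
    (innerSL ℂ) Real.continuous_probChar hL hf hg
  have h1 : ∀ v, planeWaveTransform s f v = ((Real.sqrt ((2 * Real.pi) ^ n))⁻¹ : ℝ) •
      VectorFourier.fourierIntegral Real.probChar volume L f v := by
    intro v
    rw [VectorFourier.fourierIntegral_probChar, planeWaveTransform]
    congr 2 with p
    simp only [L, LinearMap.smul_apply, dotProductBilin_apply_apply, dotProduct, smul_eq_mul]
    rw [mul_comm]
    congr 2
    push_cast
    ring
  have h2 : ∀ v, planeWaveTransform (-s) g v = ((Real.sqrt ((2 * Real.pi) ^ n))⁻¹ : ℝ) •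
      VectorFourier.fourierIntegral Real.probChar volume (-L.flip) g v := by
    intro v
    rw [VectorFourier.fourierIntegral_probChar, planeWaveTransform]
    congr 2 with p
    simp only [L, LinearMap.smul_apply, dotProductBilin_apply_apply, dotProduct, smul_eq_mul,
      LinearMap.neg_apply, LinearMap.flip_apply]
    rw [mul_comm]
    congr 2
    simp_rw [mul_comm (p _)]
    push_cast
    ring
  simp_rw [h1, h2, real_smul, map_mul, conj_ofReal, mul_assoc, mul_left_comm (starRingEnd ℂ _)]
  rw [integral_const_mul, integral_const_mul]
  congr 1
  simp only [innerSL_apply_apply, RCLike.inner_apply'] at h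
  exact h

/-- The phase space `ℝⁿ × ℝⁿ`. -/
abbrev PhaseSpace (n : ℕ) : Type := (Fin n → ℝ) × (Fin n → ℝ)

/-- The transform `planeWaveTransform` in the momentum variable of a phase-space function. -/
noncomputable def partialTransform {n : ℕ} (s : ℝ) (h : PhaseSpace n → ℂ) (z : PhaseSpace n) : ℂ :=
  planeWaveTransform s (fun p => h (z.1, p)) z.2

section partialTransform

variable {n : ℕ} {s : ℝ} {h k : PhaseSpace n → ℂ}

theorem ae_memLp_two_section (h2 : MemLp h 2) : ∀ᵐ q, MemLp (fun p => h (q, p)) 2 := by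
  have h2' := (memLp_two_iff_integrable_sq_norm h2.1).1 h2
  have hm : ∀ᵐ q, AEStronglyMeasurable (fun p => h (q, p)) := h2.1.prodMk_left
  filter_upwards [h2'.prod_right_ae, hm] with q hq hqm
  exact (memLp_two_iff_integrable_sq_norm hqm).2 hq

theorem stronglyMeasurable_partialTransform (hm : StronglyMeasurable h) :
    StronglyMeasurable (partialTransform s h) := by
  have : StronglyMeasurable fun w : PhaseSpace n × (Fin n → ℝ) =>
      h (w.1.1, w.2) * exp (I * ((s * ∑ i, w.2 i * w.1.2 i : ℝ) : ℂ)) := by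
    refine (hm.comp_measurable (by fun_prop)).mul (Continuous.stronglyMeasurable ?_)
    fun_prop
  have hint := this.integral_prod_right (ν := volume) (f := fun (z : PhaseSpace n) p =>
    h (z.1, p) * exp (I * ((s * ∑ i, p i * z.2 i : ℝ) : ℂ)))
  exact hint.const_smul (Real.sqrt ((2 * Real.pi) ^ n))⁻¹

theorem partialTransform_congr_ae (hk : h =ᵐ[volume] k) :
    partialTransform s h =ᵐ[volume] partialTransform s k := by
  have h1 : ∀ᵐ q : Fin n → ℝ, ∀ᵐ p : Fin n → ℝ, h (q, p) = k (q, p) :=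
    Measure.ae_ae_of_ae_prod hk
  filter_upwards [Measure.quasiMeasurePreserving_fst.ae h1] with z hz
  simp only [partialTransform, planeWaveTransform]
  congr 1
  refine integral_congr_ae ?_
  filter_upwards [hz] with p hp
  rw [hp]

theorem lintegral_enorm_sq_partialTransform (hs : |s| = 1) (hm : StronglyMeasurable h)
    (hi : Integrable h) (h2 : MemLp h 2) :
    ∫⁻ z, ‖partialTransform s h z‖ₑ ^ 2 = ∫⁻ z, ‖h z‖ₑ ^ 2 := by
  have hi' : ∀ᵐ q, Integrable fun p => h (q, p) := Integrable.prod_right_ae hi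
  have m1 : Measurable fun z => ‖partialTransform s h z‖ₑ ^ 2 :=
    (stronglyMeasurable_partialTransform hm).enorm.pow_const 2
  have m2 : Measurable fun z => ‖h z‖ₑ ^ 2 := hm.enorm.pow_const 2
  rw [Measure.volume_eq_prod, lintegral_prod _ m1.aemeasurable, lintegral_prod _ m2.aemeasurable]
  refine lintegral_congr_ae ?_
  filter_upwards [hi', ae_memLp_two_section h2] with q hq1 hq2
  simpa only [partialTransform] using lintegral_enorm_sq_planeWaveTransform hs hq1 hq2

theorem eLpNorm_partialTransform (hs : |s| = 1) (hm : StronglyMeasurable h)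
    (hi : Integrable h) (h2 : MemLp h 2) :
    eLpNorm (partialTransform s h) 2 volume = eLpNorm h 2 volume := by
  rw [eLpNorm_eq_lintegral_rpow_enorm_toReal (by norm_num) (by norm_num),
    eLpNorm_eq_lintegral_rpow_enorm_toReal (by norm_num) (by norm_num)]
  simpa using congrArg (· ^ (2⁻¹ : ℝ)) (lintegral_enorm_sq_partialTransform hs hm hi h2)

theorem memLp_partialTransform (hs : |s| = 1) (hm : StronglyMeasurable h)
    (hi : Integrable h) (h2 : MemLp h 2) : MemLp (partialTransform s h) 2 :=
  ⟨(stronglyMeasurable_partialTransform hm).aestronglyMeasurable,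
    (eLpNorm_partialTransform hs hm hi h2).trans_lt h2.2⟩

theorem planeWaveTransform_add {f g : (Fin n → ℝ) → ℂ} (hf : Integrable f) (hg : Integrable g)
    (v : Fin n → ℝ) :
    planeWaveTransform s (f + g) v = planeWaveTransform s f v + planeWaveTransform s g v := by
  have hb : ∀ {f : (Fin n → ℝ) → ℂ}, Integrable f →
      Integrable fun p => f p * exp (I * ((s * ∑ i, p i * v i : ℝ) : ℂ)) := fun hf =>
    hf.mul_bdd (c := 1) (Continuous.aestronglyMeasurable (by fun_prop))
      (.of_forall fun p => by rw [norm_exp_I_mul_ofReal])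
  simp only [planeWaveTransform, Pi.add_apply, add_mul]
  rw [integral_add (hb hf) (hb hg), smul_add]

theorem partialTransform_add (hi : Integrable h) (ki : Integrable k) :
    partialTransform s (h + k) =ᵐ[volume] partialTransform s h + partialTransform s k := by
  filter_upwards [Measure.quasiMeasurePreserving_fst.ae hi.prod_right_ae,
    Measure.quasiMeasurePreserving_fst.ae ki.prod_right_ae] with z hz kz
  exact planeWaveTransform_add hz kz z.2

theorem partialTransform_const_smul (c : ℂ) :
    partialTransform s (c • h) = c • partialTransform s h := by
  ext z
  simp only [partialTransform, planeWaveTransform, Pi.smul_apply, smul_eq_mul, mul_assoc]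
  rw [integral_const_mul, mul_smul_comm]

theorem integral_conj_partialTransform_mul (hs : |s| = 1)
    (hm : StronglyMeasurable h) (hi : Integrable h) (h2 : MemLp h 2)
    (km : StronglyMeasurable k) (ki : Integrable k) (k2 : MemLp k 2) :
    ∫ z, (starRingEnd ℂ) (partialTransform s h z) * k z =
      ∫ z, (starRingEnd ℂ) (h z) * partialTransform (-s) k z := by
  have e1 : Integrable fun z => (starRingEnd ℂ) (partialTransform s h z) * k z :=
    (memLp_partialTransform hs hm hi h2).star.integrable_mul k2
  have e2 : Integrable fun z => (starRingEnd ℂ) (h z) * partialTransform (-s) k z :=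
    h2.star.integrable_mul (memLp_partialTransform (by rwa [abs_neg]) km ki k2)
  have hi' : ∀ᵐ q, Integrable fun p => h (q, p) := Integrable.prod_right_ae hi
  have ki' : ∀ᵐ q, Integrable fun p => k (q, p) := Integrable.prod_right_ae ki
  rw [Measure.volume_eq_prod] at e1 e2 ⊢
  rw [integral_prod _ e1, integral_prod _ e2]
  refine integral_congr_ae ?_
  filter_upwards [hi', ki'] with q hq kq
  simpa only [partialTransform] using integral_conj_planeWaveTransform_mul s hq kq

end partialTransform

/-- Square-integrable functions on phase space. -/
abbrev PhaseL2 (n : ℕ) : Type := Lp ℂ 2 (volume : Measure (PhaseSpace n))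

/-- The subspace `L¹ ∩ L²` of `L²`. -/
def integrableSubmodule (n : ℕ) : Submodule ℂ (PhaseL2 n) where
  carrier := {h | Integrable h volume}
  add_mem' {h k} hh hk :=
    (Integrable.add (f := h) (g := k) hh hk).congr (Lp.coeFn_add h k).symm
  zero_mem' := (integrable_zero _ _ _).congr (Lp.coeFn_zero _ _ _).symm
  smul_mem' c h hh := (Integrable.smul (f := h) c hh).congr (Lp.coeFn_smul c h).symm

theorem denseRange_integrableSubmodule_subtype (n : ℕ) :
    DenseRange (integrableSubmodule n).subtype := by
  have : (volume : Measure (PhaseSpace n)).IsAddHaarMeasure :=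
    Measure.prod.instIsAddHaarMeasure (volume : Measure (Fin n → ℝ)) volume
  refine (SchwartzMap.denseRange_toLpCLM (E := PhaseSpace n) (F := ℂ) (μ := volume)
    (p := 2) (by norm_num)).mono ?_
  rintro _ ⟨φ, rfl⟩
  exact ⟨⟨φ.toLp 2, φ.integrable.congr (φ.coeFn_toLp 2).symm⟩, rfl⟩

section partialTransformL2

variable {n : ℕ} {s : ℝ}

/-- The partial transform as a linear map from `L¹ ∩ L²` to `L²`. -/
noncomputable def integrablePartialTransform (n : ℕ) {s : ℝ} (hs : |s| = 1) :
    integrableSubmodule n →ₗ[ℂ] PhaseL2 n where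
  toFun h := (memLp_partialTransform hs (Lp.stronglyMeasurable h.1) h.2 (Lp.memLp h.1)).toLp _
  map_add' h k := by
    rw [← MemLp.toLp_add, MemLp.toLp_eq_toLp_iff]
    exact (partialTransform_congr_ae (Lp.coeFn_add h.1 k.1)).trans (partialTransform_add h.2 k.2)
  map_smul' c h := by
    rw [RingHom.id_apply, ← MemLp.toLp_const_smul, MemLp.toLp_eq_toLp_iff,
      ← partialTransform_const_smul]
    exact partialTransform_congr_ae (Lp.coeFn_smul c h.1)

theorem norm_integrablePartialTransform (hs : |s| = 1) (h : integrableSubmodule n) :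
    ‖integrablePartialTransform n hs h‖ = ‖h‖ := by
  simp only [integrablePartialTransform, LinearMap.coe_mk, AddHom.coe_mk]
  rw [Lp.norm_toLp, eLpNorm_partialTransform hs (Lp.stronglyMeasurable h.1) h.2 (Lp.memLp h.1)]
  rfl

/-- The continuous extension of the partial transform to `L²`. -/
noncomputable def partialTransformL2 (n : ℕ) {s : ℝ} (hs : |s| = 1) : PhaseL2 n →L[ℂ] PhaseL2 n :=
  (integrablePartialTransform n hs).extendOfNorm (integrableSubmodule n).subtype

theorem partialTransformL2_coe (hs : |s| = 1) (h : integrableSubmodule n) :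
    partialTransformL2 n hs h = integrablePartialTransform n hs h :=
  LinearMap.extendOfNorm_eq (denseRange_integrableSubmodule_subtype n)
    ⟨1, fun h => by rw [one_mul, norm_integrablePartialTransform]; rfl⟩ h

theorem coeFn_partialTransformL2 (hs : |s| = 1) {h : PhaseL2 n} (hi : Integrable h) :
    partialTransformL2 n hs h =ᵐ[volume] partialTransform s h := by
  rw [show h = ((⟨h, hi⟩ : integrableSubmodule n) : PhaseL2 n) from rfl, partialTransformL2_coe]
  exact (memLp_partialTransform hs (Lp.stronglyMeasurable h) hi (Lp.memLp h)).coeFn_toLp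

theorem norm_partialTransformL2 (hs : |s| = 1) (h : PhaseL2 n) :
    ‖partialTransformL2 n hs h‖ = ‖h‖ := by
  refine (denseRange_integrableSubmodule_subtype n).induction_on
    (p := fun h => ‖partialTransformL2 n hs h‖ = ‖h‖) h
    (isClosed_eq (by fun_prop) continuous_norm) fun h => ?_
  rw [Submodule.subtype_apply, partialTransformL2_coe, norm_integrablePartialTransform]
  rfl

theorem inner_partialTransformL2 (hs : |s| = 1) (h k : PhaseL2 n) :
    inner ℂ (partialTransformL2 n hs h) k =
      inner ℂ h (partialTransformL2 n (s := -s) (by rwa [abs_neg]) k) := by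
  refine (denseRange_integrableSubmodule_subtype n).induction_on₂
    (p := fun h k => inner ℂ (partialTransformL2 n hs h) k =
      inner ℂ h (partialTransformL2 n (s := -s) (by rwa [abs_neg]) k))
    (isClosed_eq (by fun_prop) (by fun_prop)) (fun h k => ?_) h k
  rw [L2.inner_def, L2.inner_def]
  simp only [RCLike.inner_apply', Submodule.subtype_apply]
  calc _ = ∫ z, (starRingEnd ℂ) (partialTransform s h.1 z) * k.1 z := by
        refine integral_congr_ae ?_
        filter_upwards [coeFn_partialTransformL2 hs h.2] with z hz
        rw [hz]
    _ = ∫ z, (starRingEnd ℂ) (h.1 z) * partialTransform (-s) k.1 z :=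
        integral_conj_partialTransform_mul hs (Lp.stronglyMeasurable _) h.2 (Lp.memLp _)
          (Lp.stronglyMeasurable _) k.2 (Lp.memLp _)
    _ = _ := by
        refine integral_congr_ae ?_
        filter_upwards [coeFn_partialTransformL2 (s := -s) (by rwa [abs_neg]) k.2] with z hz
        rw [hz]

theorem surjective_partialTransformL2 (hs : |s| = 1) :
    Function.Surjective (partialTransformL2 n hs) := by
  have hs' : |-s| = 1 := by rwa [abs_neg]
  let U : PhaseL2 n →ₗᵢ[ℂ] PhaseL2 n :=
    ⟨(partialTransformL2 n hs').toLinearMap, norm_partialTransformL2 hs'⟩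
  refine fun k => ⟨partialTransformL2 n hs' k, ext_inner_right ℂ fun l => ?_⟩
  rw [inner_partialTransformL2]
  exact U.inner_map_map k l

end partialTransformL2

/-- The change of variables `(x, y) ↦ ((x + y) / 2, x - y)`. -/
noncomputable def weylCoordinates (n : ℕ) : PhaseSpace n ≃ᵐ PhaseSpace n where
  toFun z := (fun i => (z.1 i + z.2 i) / 2, z.1 - z.2)
  invFun w := (w.1 + (2⁻¹ : ℝ) • w.2, w.1 - (2⁻¹ : ℝ) • w.2)
  left_inv z := by
    ext i <;> simp <;> ring
  right_inv w := by
    ext i <;> simp <;> ring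
  measurable_toFun := by
    simp only [Equiv.coe_fn_mk]
    fun_prop
  measurable_invFun := by
    simp only [Equiv.coe_fn_symm_mk]
    fun_prop

theorem measurePreserving_weylCoordinates (n : ℕ) : MeasurePreserving (weylCoordinates n) := by
  have h1 : MeasurePreserving (fun z : PhaseSpace n => (z.2, z.1 - z.2)) :=
    measurePreserving_prod_sub_swap volume volume
  have h2 : MeasurePreserving (fun z : PhaseSpace n => (z.1, (2⁻¹ : ℝ) • z.1 + z.2)) :=
    (MeasurePreserving.id volume).skew_product (g := fun v y => (2⁻¹ : ℝ) • v + y)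
      (by fun_prop) (.of_forall fun v => map_add_left_eq_self volume _)
  have h3 : MeasurePreserving (Prod.swap : PhaseSpace n → PhaseSpace n) :=
    Measure.measurePreserving_swap
  convert (h3.comp (h2.comp (h3.comp h1))) using 1
  ext z i
  · simp [weylCoordinates]
    ring
  · simp [weylCoordinates]

/-- the Weyl kernel map `h ↦ K_h` — the partial Fourier transform in the
second variable composed with the measure-preserving change of variables
`(x,y) ↦ ((x+y)/2, x−y)`, formally
`K_h(x,y) = (2π)^{−n} ∫ h((x+y)/2, p) e^{i⟨p, x−y⟩} dp` — extends to a linear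
bijection `T` of `L²(ℝⁿ × ℝⁿ; ℂ)` onto itself which is a constant multiple of an
isometry: `‖T h‖ = (2π)^{−n/2} ‖h‖`, and which is given by the above integral formula
whenever `h` is integrable.  Since an operator is Hilbert–Schmidt iff it is an
integral operator with square-integrable kernel, with Hilbert–Schmidt norm the `L²`
norm of the kernel, this says precisely that for every `h ∈ L²` the Weyl operator
`Op(h)` with kernel `K_h = T h` is Hilbert–Schmidt with Hilbert–Schmidt norm
`(2π)^{−n/2} ‖h‖_{L²}`: Weyl quantization works for all `L²` classical Hamilton
functions. -/
theorem weyl_quantization_hilbert_schmidt (n : ℕ) (hn : 1 ≤ n) :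
    ∃ T : Lp ℂ 2 (volume : Measure ((Fin n → ℝ) × (Fin n → ℝ))) →ₗ[ℂ]
        Lp ℂ 2 (volume : Measure ((Fin n → ℝ) × (Fin n → ℝ))),
      Function.Bijective T ∧
      (∀ h, ‖T h‖ = (Real.sqrt ((2 * Real.pi) ^ n))⁻¹ * ‖h‖) ∧
      (∀ h : Lp ℂ 2 (volume : Measure ((Fin n → ℝ) × (Fin n → ℝ))),
        Integrable (h : (Fin n → ℝ) × (Fin n → ℝ) → ℂ) volume →
          (T h : (Fin n → ℝ) × (Fin n → ℝ) → ℂ) =ᵐ[volume] fun z =>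
            (((2 * Real.pi) ^ n)⁻¹ : ℝ) •
              ∫ p : Fin n → ℝ,
                (h : (Fin n → ℝ) × (Fin n → ℝ) → ℂ)
                    ((fun i => (z.1 i + z.2 i) / 2), p) *
                  Complex.exp (Complex.I * ((∑ i, p i * (z.1 i - z.2 i) : ℝ) : ℂ))) := by
  have hpos : 0 < (2 * Real.pi) ^ n := by positivity
  set c : ℝ := (Real.sqrt ((2 * Real.pi) ^ n))⁻¹ with hc
  have hc0 : 0 < c := by positivity
  have hcc : c * c = ((2 * Real.pi) ^ n)⁻¹ := by
    rw [hc, ← mul_inv, Real.mul_self_sqrt hpos.le]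
  have hmp := measurePreserving_weylCoordinates n
  let M : PhaseL2 n →ₗᵢ[ℂ] PhaseL2 n := Lp.compMeasurePreservingₗᵢ ℂ _ hmp
  have hM : Function.Surjective M := by
    intro g
    refine ⟨Lp.compMeasurePreserving _ hmp.symm g, ?_⟩
    change Lp.compMeasurePreserving _ hmp (Lp.compMeasurePreserving _ hmp.symm g) = g
    rw [← Lp.compMeasurePreserving_comp_apply]
    simp only [(weylCoordinates n).symm_comp_self]
    exact Lp.compMeasurePreserving_id_apply g
  let S := partialTransformL2 n abs_one
  let T : PhaseL2 n →ₗ[ℂ] PhaseL2 n := (c : ℂ) • (M.toLinearMap ∘ₗ S.toLinearMap)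
  have hT : ∀ h, T h = (c : ℂ) • M (S h) := fun h => rfl
  have hnorm : ∀ h, ‖T h‖ = c * ‖h‖ := by
    intro h
    rw [hT, norm_smul, M.norm_map, norm_partialTransformL2, norm_real, Real.norm_of_nonneg hc0.le]
  refine ⟨T, ⟨?_, ?_⟩, hnorm, ?_⟩
  · refine (injective_iff_map_eq_zero T).2 fun h hh => ?_
    have := hnorm h
    rw [hh, norm_zero, zero_eq_mul, norm_eq_zero] at this
    exact this.resolve_left hc0.ne'
  · intro g
    obtain ⟨g', hg'⟩ := hM ((c : ℂ)⁻¹ • g)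
    obtain ⟨h, hh⟩ := surjective_partialTransformL2 abs_one g'
    refine ⟨h, ?_⟩
    rw [hT, hh, hg', smul_inv_smul₀ (by exact_mod_cast hc0.ne')]
  · intro h hi
    have h1 : M (S h) =ᵐ[volume] S h ∘ weylCoordinates n := Lp.coeFn_compMeasurePreserving _ hmp
    filter_upwards [Lp.coeFn_smul (c : ℂ) (M (S h)), h1,
      hmp.quasiMeasurePreserving.ae (coeFn_partialTransformL2 abs_one hi)] with z hz1 hz2 hz3
    rw [hT, hz1, Pi.smul_apply, hz2, Function.comp_apply, hz3, ← hcc, mul_smul, coe_smul,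
      partialTransform, planeWaveTransform]
    simp only [one_mul]
    rfl
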